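/- Let p ∈ (0,1), let L, M be positive integers, and let A be a random L×M real matrix with i.i.d. Bernoulli–Gaussian entries of parameter p. Define R₂(A) := inf_{z ∈ ℝ^L, z ≠ 0} ‖Aᵀz‖₁/‖z‖₂. Then for every ε ∈ (0,1), ℙ( R₂(A) < M·p·(√(2/π) − 2ε − ε²) ) ≤ 2·[ (3/ε · √(L/p))^L + 1 ]·exp( − M·p·ε² / (2 + √2·ε) ). -/

import Mathlib

open MeasureTheory Finset
open scoped ENNReal

noncomputable section

/-- The Bernoulli–Gaussian measure `ν_p = (1−p)·δ₀ + p·N(0,1)` on `ℝ`. -/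
def bernoulliGaussian (p : ℝ) : Measure ℝ :=
  (1 - p).toNNReal • Measure.dirac (0 : ℝ)
    + p.toNNReal • ProbabilityTheory.gaussianReal 0 1

instance (p : ℝ) : IsFiniteMeasure (bernoulliGaussian p) := by
  unfold bernoulliGaussian; infer_instance

open ProbabilityTheory
open scoped NNReal

lemma isProbabilityMeasure_bernoulliGaussian {p : ℝ} (hp0 : 0 ≤ p) (hp1 : p ≤ 1) :
    IsProbabilityMeasure (bernoulliGaussian p) := by
  constructor
  simp only [bernoulliGaussian, Measure.coe_add, Measure.coe_nnreal_smul_apply, Pi.add_apply,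
    measure_univ, mul_one]
  rw [← ENNReal.coe_add, ← Real.toNNReal_add (by linarith) hp0]
  simp

lemma integral_bernoulliGaussian {p : ℝ} (hp0 : 0 ≤ p) (hp1 : p ≤ 1) {f : ℝ → ℝ}
    (hf : Integrable f (gaussianReal 0 1)) :
    ∫ x, f x ∂bernoulliGaussian p = (1 - p) * f 0 + p * ∫ x, f x ∂gaussianReal 0 1 := by
  have hd : Integrable f (Measure.dirac (0 : ℝ)) := integrable_dirac (by simp)
  rw [bernoulliGaussian, integral_add_measure hd.smul_measure_nnreal hf.smul_measure_nnreal,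
    integral_smul_nnreal_measure, integral_smul_nnreal_measure, integral_dirac,
    NNReal.smul_def, NNReal.smul_def, Real.coe_toNNReal _ (by linarith), Real.coe_toNNReal _ hp0,
    smul_eq_mul, smul_eq_mul]

lemma integrable_bernoulliGaussian (p : ℝ) {f : ℝ → ℝ}
    (hf : Integrable f (gaussianReal 0 1)) : Integrable f (bernoulliGaussian p) :=
  (Integrable.smul_measure_nnreal (integrable_dirac (by simp))).add_measure hf.smul_measure_nnreal

lemma memLp_id_bernoulliGaussian (p : ℝ) : MemLp id 2 (bernoulliGaussian p) := by
  rw [memLp_two_iff_integrable_sq aestronglyMeasurable_id]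
  exact integrable_bernoulliGaussian p (memLp_id_gaussianReal 2).integrable_sq

lemma integral_id_bernoulliGaussian {p : ℝ} (hp0 : 0 ≤ p) (hp1 : p ≤ 1) :
    ∫ x, x ∂bernoulliGaussian p = 0 := by
  rw [integral_bernoulliGaussian hp0 hp1 (f := fun x => x)
    ((memLp_id_gaussianReal 2).integrable (by norm_num))]
  simp

lemma variance_id_bernoulliGaussian {p : ℝ} (hp0 : 0 ≤ p) (hp1 : p ≤ 1) :
    Var[id; bernoulliGaussian p] = p := by
  have h := variance_of_integral_eq_zero (X := id) (μ := gaussianReal 0 1) aemeasurable_id (by simp)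
  rw [variance_id_gaussianReal] at h
  rw [variance_of_integral_eq_zero aemeasurable_id (integral_id_bernoulliGaussian hp0 hp1),
    integral_bernoulliGaussian hp0 hp1 (f := fun x => id x ^ 2)
      (memLp_id_gaussianReal 2).integrable_sq, ← h]
  simp

lemma memLp_linear_pi_bernoulliGaussian {p : ℝ} (hp0 : 0 ≤ p) (hp1 : p ≤ 1)
    {ι : Type*} [Fintype ι] (z : ι → ℝ) :
    MemLp (fun x : ι → ℝ => ∑ l, x l * z l) 2 (Measure.pi fun _ => bernoulliGaussian p) := by
  have := isProbabilityMeasure_bernoulliGaussian hp0 hp1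
  refine memLp_finsetSum _ fun l _ => ?_
  exact ((memLp_id_bernoulliGaussian p).comp_measurePreserving
    (measurePreserving_eval (fun _ : ι => bernoulliGaussian p) l)).mul_const (z l)

lemma integral_linear_sq_pi_bernoulliGaussian {p : ℝ} (hp0 : 0 ≤ p) (hp1 : p ≤ 1)
    {ι : Type*} [Fintype ι] (z : ι → ℝ) :
    ∫ x : ι → ℝ, (∑ l, x l * z l) ^ 2 ∂(Measure.pi fun _ => bernoulliGaussian p)
      = p * ∑ l, z l ^ 2 := by
  have := isProbabilityMeasure_bernoulliGaussian hp0 hp1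
  have hint (l : ι) : MemLp (fun x : ℝ => x * z l) 2 (bernoulliGaussian p) :=
    (memLp_id_bernoulliGaussian p).mul_const (z l)
  have h0 : ∫ x : ι → ℝ, ∑ l, x l * z l ∂(Measure.pi fun _ => bernoulliGaussian p) = 0 := by
    rw [integral_finsetSum _ fun l _ => integrable_comp_eval
        (μ := fun _ : ι => bernoulliGaussian p) (i := l) (f := fun x => x * z l)
        ((hint l).integrable (by norm_num))]
    refine Finset.sum_eq_zero fun l _ => ?_
    rw [integral_comp_eval (μ := fun _ : ι => bernoulliGaussian p) (i := l)
        (f := fun x : ℝ => x * z l) (by fun_prop), integral_mul_const,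
      integral_id_bernoulliGaussian hp0 hp1, zero_mul]
  have hv := variance_sum_pi (μ := fun _ : ι => bernoulliGaussian p) hint
  have he : (∑ l, fun x : ι → ℝ => x l * z l) = fun x => ∑ l, x l * z l := by
    ext x; simp
  rw [he, variance_of_integral_eq_zero
    (memLp_linear_pi_bernoulliGaussian hp0 hp1 z).aemeasurable h0] at hv
  rw [hv, Finset.mul_sum]
  refine Finset.sum_congr rfl fun l _ => ?_
  rw [variance_mul_const]
  exact congrArg (· * _) (variance_id_bernoulliGaussian hp0 hp1)

lemma integral_abs_gaussianReal_zero_one :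
    ∫ x, |x| ∂gaussianReal 0 1 = Real.sqrt (2 / Real.pi) := by
  have h := integral_rpow_mul_exp_neg_mul_rpow (p := 2) (q := 1) (b := 2⁻¹)
    (by norm_num) (by norm_num) (by norm_num)
  norm_num [Real.Gamma_one, Real.rpow_neg_one] at h
  have hpt (x : ℝ) : gaussianPDFReal 0 1 x • |x|
      = (Real.sqrt (2 * Real.pi))⁻¹ * (|x| * Real.exp (-(1 / 2 * |x| ^ 2))) := by
    rw [gaussianPDFReal, smul_eq_mul, sq_abs]
    simp only [NNReal.coe_one, sub_zero, mul_one]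
    ring_nf
  rw [integral_gaussianReal_eq_integral_smul one_ne_zero]
  simp_rw [hpt]
  rw [integral_const_mul,
    integral_comp_abs (f := fun x => x * Real.exp (-(1 / 2 * x ^ 2))), h,
    Real.sqrt_mul (by norm_num), Real.sqrt_div (by norm_num)]
  have := Real.sq_sqrt (show (0 : ℝ) ≤ 2 by norm_num)
  have h2 : Real.sqrt Real.pi ≠ 0 := by positivity
  field_simp
  linarith

lemma lintegral_abs_gaussianReal (c : ℝ≥0) :
    ∫⁻ x, ‖x‖ₑ ∂gaussianReal 0 c = ENNReal.ofReal (Real.sqrt (2 / Real.pi) * Real.sqrt c) := by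
  have h : gaussianReal 0 c = (gaussianReal 0 1).map (Real.sqrt c * ·) := by
    rw [gaussianReal_map_const_mul]
    congr 1
    · simp
    · ext; simp
  rw [h, lintegral_map (by fun_prop) (by fun_prop)]
  simp_rw [enorm_mul]
  rw [lintegral_const_mul _ (by fun_prop), mul_comm, ENNReal.ofReal_mul (by positivity),
    ← integral_abs_gaussianReal_zero_one,
    ofReal_integral_eq_lintegral_ofReal
      (f := fun x => |x|)
      ((memLp_id_gaussianReal 1).integrable (by norm_num)).abs (ae_of_all _ fun x => abs_nonneg x)]
  simp_rw [← Real.norm_eq_abs, ofReal_norm]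
  rw [Real.enorm_of_nonneg (Real.sqrt_nonneg _)]

lemma map_mul_const_bernoulliGaussian (p c : ℝ) :
    (bernoulliGaussian p).map (· * c) = ENNReal.ofReal (1 - p) • Measure.dirac (0 : ℝ)
      + ENNReal.ofReal p • gaussianReal 0 (Real.toNNReal (c ^ 2)) := by
  have h : bernoulliGaussian p = ENNReal.ofReal (1 - p) • Measure.dirac (0 : ℝ)
      + ENNReal.ofReal p • gaussianReal 0 1 := rfl
  rw [h, Measure.map_add _ _ (by fun_prop), Measure.map_smul, Measure.map_smul,
    Measure.map_dirac' (by fun_prop), gaussianReal_map_mul_const, zero_mul, mul_zero, mul_one]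
  congr 3
  ext
  simp [sq_nonneg]

/-- First moment bound for a partially Gaussian linear form: a Gaussian of variance `c` replaces
the coordinates already processed, and `c ≤ √c` on `[0, 1]` closes the induction. -/
lemma le_lintegral_abs_conv_linear {p : ℝ} (hp0 : 0 ≤ p) (hp1 : p ≤ 1) {ι : Type*} [Fintype ι]
    (z : ι → ℝ) (s : Finset ι) (c : ℝ≥0) (hc : c + ∑ l ∈ s, z l ^ 2 ≤ 1) :
    ENNReal.ofReal (Real.sqrt (2 / Real.pi) * (c + p * ∑ l ∈ s, z l ^ 2))
      ≤ ∫⁻ y, ‖y‖ₑ ∂(gaussianReal 0 c ∗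
        (Measure.pi fun _ => bernoulliGaussian p).map fun x : ι → ℝ => ∑ l ∈ s, x l * z l) := by
  classical
  have := isProbabilityMeasure_bernoulliGaussian hp0 hp1
  set P := Measure.pi fun _ : ι => bernoulliGaussian p with hP
  induction s using Finset.induction_on generalizing c with
  | empty =>
    simp only [Finset.sum_empty, add_zero, mul_zero, Measure.map_const, measure_univ, one_smul,
      Measure.conv_dirac_zero] at hc ⊢
    rw [lintegral_abs_gaussianReal]
    gcongr
    exact Real.le_sqrt_of_sq_le (by nlinarith [c.coe_nonneg])
  | insert a s ha ih =>
    rw [Finset.sum_insert ha] at hc ⊢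
    set S : (ι → ℝ) → ℝ := fun x => ∑ l ∈ s, x l * z l
    have hS : Measurable S := by fun_prop
    have hza := sq_nonneg (z a)
    have hind : iIndepFun (fun (l : ι) (x : ι → ℝ) => x l * z l) P :=
      iIndepFun_pi (X := fun l (y : ℝ) => y * z l) (fun l => by fun_prop)
    have hi : IndepFun (fun x : ι → ℝ => x a * z a) S P := by
      have h := (hind.indepFun_finsetSum_of_notMem (fun l => by fun_prop) ha).symm
      convert h using 1
      ext x
      simp [S]
    have hlaw : P.map (fun x => ∑ l ∈ insert a s, x l * z l)
        = (ENNReal.ofReal (1 - p) • Measure.dirac (0 : ℝ)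
          + ENNReal.ofReal p • gaussianReal 0 (Real.toNNReal (z a ^ 2))) ∗ P.map S := by
      rw [← map_mul_const_bernoulliGaussian,
        ← (measurePreserving_eval (fun _ : ι => bernoulliGaussian p) a).map_eq,
        Measure.map_map (by fun_prop) (by fun_prop)]
      have h := hi.map_add_eq_map_conv_map₀
        (Measurable.aemeasurable (by fun_prop)) hS.aemeasurable
      rw [← hP]
      convert h using 2
      · ext x
        simp [S, Finset.sum_insert ha]
      · rfl
    have : IsProbabilityMeasure (P.map S) := Measure.isProbabilityMeasure_map hS.aemeasurable
    rw [hlaw, Measure.add_conv, Measure.conv_smul_left, Measure.conv_smul_left,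
      Measure.dirac_zero_conv, Measure.conv_add, Measure.conv_smul_right, Measure.conv_smul_right,
      ← Measure.conv_assoc, gaussianReal_conv_gaussianReal, add_zero, lintegral_add_measure,
      lintegral_smul_measure, lintegral_smul_measure]
    have h1 := ih c (by linarith)
    have h2 := ih (c + Real.toNNReal (z a ^ 2)) (by
      rw [NNReal.coe_add, Real.coe_toNNReal _ hza]; linarith)
    rw [NNReal.coe_add, Real.coe_toNNReal _ hza] at h2
    have hs : 0 ≤ ∑ l ∈ s, z l ^ 2 := Finset.sum_nonneg fun l _ => sq_nonneg _
    calc _ = ENNReal.ofReal (1 - p)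
            * ENNReal.ofReal (Real.sqrt (2 / Real.pi) * (c + p * ∑ l ∈ s, z l ^ 2))
          + ENNReal.ofReal p
            * ENNReal.ofReal (Real.sqrt (2 / Real.pi) * (c + z a ^ 2 + p * ∑ l ∈ s, z l ^ 2)) := by
          rw [← ENNReal.ofReal_mul (by linarith), ← ENNReal.ofReal_mul hp0,
            ← ENNReal.ofReal_add (mul_nonneg (by linarith) (by positivity)) (by positivity)]
          congr 1
          ring
      _ ≤ _ := by
          rw [smul_eq_mul, smul_eq_mul]
          gcongr

lemma le_integral_abs_linear_pi_bernoulliGaussian {p : ℝ} (hp0 : 0 ≤ p) (hp1 : p ≤ 1)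
    {ι : Type*} [Fintype ι] {z : ι → ℝ} (hz : ∑ l, z l ^ 2 = 1) :
    p * Real.sqrt (2 / Real.pi)
      ≤ ∫ x : ι → ℝ, |∑ l, x l * z l| ∂(Measure.pi fun _ => bernoulliGaussian p) := by
  have := isProbabilityMeasure_bernoulliGaussian hp0 hp1
  have h := le_lintegral_abs_conv_linear hp0 hp1 z Finset.univ 0 (by simp [hz])
  have : IsProbabilityMeasure ((Measure.pi fun _ => bernoulliGaussian p).map
    fun x : ι → ℝ => ∑ l, x l * z l) := Measure.isProbabilityMeasure_map
      (Measurable.aemeasurable (by fun_prop))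
  rw [gaussianReal_zero_var, Measure.dirac_zero_conv, lintegral_map (by fun_prop) (by fun_prop),
    hz] at h
  have hi := ((memLp_linear_pi_bernoulliGaussian hp0 hp1 z).integrable (by norm_num)).abs
  rw [← ENNReal.ofReal_le_ofReal_iff (integral_nonneg fun x => abs_nonneg _),
    ofReal_integral_eq_lintegral_ofReal hi (ae_of_all _ fun x => abs_nonneg _)]
  simp_rw [← Real.norm_eq_abs, ofReal_norm]
  convert h using 2
  simp [mul_comm]

/-- A finite subset of the unit sphere that is `δ`-dense in it, of cardinality at most
`(3/δ)^dim`. -/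
lemma exists_finset_net_sphere {E : Type*} [NormedAddCommGroup E] [NormedSpace ℝ E]
    [FiniteDimensional ℝ E] {δ : ℝ} (hδ0 : 0 < δ) (hδ1 : δ ≤ 1) :
    ∃ s : Finset E, (∀ c ∈ s, ‖c‖ = 1) ∧ (s.card : ℝ) ≤ (3 / δ) ^ Module.finrank ℝ E ∧
      ∀ z : E, ‖z‖ = 1 → ∃ c ∈ s, ‖z - c‖ ≤ δ := by
  classical
  have hcard (s : Finset E) (hs : ∀ c ∈ s, ‖c‖ = 1)
      (h : ∀ c ∈ s, ∀ d ∈ s, c ≠ d → δ ≤ ‖c - d‖) :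
      (s.card : ℝ) ≤ (3 / δ) ^ Module.finrank ℝ E := by
    borelize E
    let μ : Measure E := Measure.addHaar
    have hdisj : Set.Pairwise (s : Set E)
        (Function.onFun Disjoint fun c => Metric.ball (c : E) (δ / 2)) := by
      rintro c hc d hd hcd
      apply Metric.ball_disjoint_ball
      rw [dist_eq_norm, add_halves]
      exact h c hc d hd hcd
    have hsub : (⋃ c ∈ s, Metric.ball (c : E) (δ / 2)) ⊆ Metric.ball (0 : E) (3 / 2) := by
      refine Set.iUnion₂_subset fun x hx => Metric.ball_subset_ball' ?_
      rw [dist_zero_right, hs x hx]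
      linarith
    have I : (s.card : ℝ≥0∞) * ENNReal.ofReal ((δ / 2) ^ Module.finrank ℝ E)
          * μ (Metric.ball 0 1)
        ≤ ENNReal.ofReal ((3 / 2) ^ Module.finrank ℝ E) * μ (Metric.ball 0 1) := by
      have := measure_mono (μ := μ) hsub
      rw [measure_biUnion_finset hdisj fun c _ => measurableSet_ball] at this
      simpa only [μ.addHaar_ball_of_pos _ (half_pos hδ0),
        μ.addHaar_ball_of_pos _ (by norm_num : (0 : ℝ) < 3 / 2), Finset.sum_const, nsmul_eq_mul,
        mul_assoc] using this
    have J := (ENNReal.mul_le_mul_iff_left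
      (Metric.measure_ball_pos _ _ zero_lt_one).ne' measure_ball_lt_top.ne).1 I
    have K := ENNReal.toReal_le_of_le_ofReal (by positivity) J
    rw [ENNReal.toReal_mul, ENNReal.toReal_natCast, ENNReal.toReal_ofReal (by positivity),
      ← le_div_iff₀ (by positivity), ← div_pow] at K
    rwa [show 3 / 2 / (δ / 2) = 3 / δ by field_simp] at K
  let P : Finset E → Prop := fun s =>
    (∀ c ∈ s, ‖c‖ = 1) ∧ ∀ c ∈ s, ∀ d ∈ s, c ≠ d → δ ≤ ‖c - d‖
  have hbdd : BddAbove {n : ℕ | ∃ s, P s ∧ s.card = n} := by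
    refine ⟨⌊(3 / δ) ^ Module.finrank ℝ E⌋₊, ?_⟩
    rintro _ ⟨s, hs, rfl⟩
    exact Nat.le_floor (hcard s hs.1 hs.2)
  obtain ⟨s, hs, hmax⟩ := Nat.sSup_mem
    (s := {n : ℕ | ∃ s, P s ∧ s.card = n}) ⟨0, ∅, by simp [P], by simp⟩ hbdd
  refine ⟨s, hs.1, hcard s hs.1 hs.2, fun z hz => ?_⟩
  by_contra! hfar
  have hzs : z ∉ s := fun hzs => by simpa using hδ0.trans (hfar z hzs)
  have hP : P (insert z s) := by
    refine ⟨by simpa [hz] using hs.1, fun c hc d hd hcd => ?_⟩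
    rcases Finset.mem_insert.1 hc with rfl | hc' <;> rcases Finset.mem_insert.1 hd with rfl | hd'
    · exact absurd rfl hcd
    · exact (hfar d hd').le
    · rw [norm_sub_rev]
      exact (hfar c hc').le
    · exact hs.2 c hc' d hd' hcd
  have := le_csSup hbdd ⟨insert z s, hP, rfl⟩
  rw [← hmax, Finset.card_insert_of_notMem hzs] at this
  omega

/-- One-sided Bernstein bound: the lower tail of a sum of i.i.d. nonnegative random variables
with mean at least `a` and second moment at most `v`. -/
lemma pi_real_sum_le_le_exp {Ω ι : Type*} [MeasurableSpace Ω] [Fintype ι] {Q : Measure Ω}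
    [IsProbabilityMeasure Q] {f : Ω → ℝ} (hf : Measurable f) (hf0 : ∀ x, 0 ≤ f x)
    (hf2 : MemLp f 2 Q) {a v t : ℝ} (ha : a ≤ ∫ x, f x ∂Q) (hv : ∫ x, f x ^ 2 ∂Q ≤ v)
    (ht : 0 ≤ t) :
    (Measure.pi fun _ : ι => Q).real {x | ∑ i, f (x i) ≤ Fintype.card ι * (a - v * t)}
      ≤ Real.exp (-(Fintype.card ι * v * t ^ 2 / 2)) := by
  have hexp_int : Integrable (fun x => Real.exp (-t * f x)) Q := by
    refine Integrable.of_bound (C := 1) (by fun_prop) (ae_of_all _ fun x => ?_)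
    rw [Real.norm_eq_abs, Real.abs_exp, Real.exp_le_one_iff]
    nlinarith [mul_nonneg ht (hf0 x)]
  have hmgf : mgf f Q (-t) ≤ Real.exp (-t * a + t ^ 2 / 2 * v) := by
    have hle (y : ℝ) (hy : 0 ≤ y) : Real.exp (-y) ≤ 1 - y + y ^ 2 / 2 := by
      have h := Real.quadratic_le_exp_of_nonneg hy
      rw [Real.exp_neg, inv_le_comm₀ (Real.exp_pos y) (by nlinarith [sq_nonneg (y - 1)])]
      refine le_trans ?_ h
      rw [inv_le_iff_one_le_mul₀ (by nlinarith [sq_nonneg (y - 1)])]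
      nlinarith [pow_nonneg hy 4]
    have h1 := hf2.integrable (by norm_num)
    have h2 := hf2.integrable_sq
    have hint : Integrable (fun x => 1 - t * f x) Q := (integrable_const _).sub (h1.const_mul t)
    calc mgf f Q (-t) ≤ ∫ x, (1 - t * f x + t ^ 2 / 2 * f x ^ 2) ∂Q := by
          refine integral_mono hexp_int (hint.add (h2.const_mul _)) fun x => ?_
          have := hle (t * f x) (mul_nonneg ht (hf0 x))
          simp only [neg_mul]
          linarith
      _ = 1 - t * ∫ x, f x ∂Q + t ^ 2 / 2 * ∫ x, f x ^ 2 ∂Q := by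
          rw [integral_add hint (h2.const_mul _),
            integral_sub (integrable_const _) (h1.const_mul t), integral_const_mul, integral_const_mul]
          simp
      _ ≤ -t * a + t ^ 2 / 2 * v + 1 := by
          have := mul_le_mul_of_nonneg_left ha ht
          have := mul_le_mul_of_nonneg_left hv (by positivity : 0 ≤ t ^ 2 / 2)
          linarith
      _ ≤ _ := Real.add_one_le_exp _
  have hind : iIndepFun (fun (i : ι) (x : ι → Ω) => f (x i)) (Measure.pi fun _ => Q) :=
    iIndepFun_pi (X := fun _ => f) fun _ => hf.aemeasurable
  have hmeas (i : ι) : Measurable fun x : ι → Ω => f (x i) := by fun_prop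
  have h := measure_le_le_exp_mul_mgf (μ := Measure.pi fun _ : ι => Q)
    (X := ∑ i, fun x : ι → Ω => f (x i)) (t := -t) (Fintype.card ι * (a - v * t)) (by linarith)
    (hind.integrable_exp_mul_sum hmeas fun i _ =>
      integrable_comp_eval (μ := fun _ : ι => Q) (f := fun y => Real.exp (-t * f y)) hexp_int)
  rw [hind.mgf_sum hmeas] at h
  have hm (i : ι) : mgf (fun x : ι → Ω => f (x i)) (Measure.pi fun _ => Q) (-t) = mgf f Q (-t) :=
    integral_comp_eval (μ := fun _ : ι => Q) (f := fun y => Real.exp (-t * f y))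
      hexp_int.aestronglyMeasurable
  simp only [hm, Finset.prod_const, Finset.card_univ, Finset.sum_apply] at h
  refine h.trans ((mul_le_mul_of_nonneg_left (pow_le_pow_left₀ mgf_nonneg hmgf _)
    (Real.exp_nonneg _)).trans_eq ?_)
  rw [← Real.exp_nat_mul, ← Real.exp_add]
  congr 1
  ring

lemma integral_exp_mul_sq_gaussianReal {s : ℝ} (hs : 0 < s) :
    ∫ x, Real.exp ((1 - (s ^ 2)⁻¹) / 2 * x ^ 2) ∂gaussianReal 0 1 = s := by
  have hpt (x : ℝ) : gaussianPDFReal 0 1 x • Real.exp ((1 - (s ^ 2)⁻¹) / 2 * x ^ 2)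
      = (Real.sqrt (2 * Real.pi))⁻¹ * Real.exp (-((s ^ 2)⁻¹ / 2) * x ^ 2) := by
    rw [gaussianPDFReal, smul_eq_mul, mul_assoc, ← Real.exp_add]
    simp only [NNReal.coe_one, sub_zero, mul_one]
    ring_nf
  rw [integral_gaussianReal_eq_integral_smul one_ne_zero]
  simp_rw [hpt]
  rw [integral_const_mul, integral_gaussian,
    show Real.pi / ((s ^ 2)⁻¹ / 2) = s ^ 2 * (2 * Real.pi) by field_simp,
    Real.sqrt_mul (sq_nonneg s), Real.sqrt_sq hs.le]
  have : Real.sqrt (2 * Real.pi) ≠ 0 := by positivity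
  field_simp

lemma integrable_exp_mul_sq_gaussianReal {s : ℝ} (hs : 0 < s) :
    Integrable (fun x => Real.exp ((1 - (s ^ 2)⁻¹) / 2 * x ^ 2)) (gaussianReal 0 1) :=
  not_imp_comm.1 integral_undef (by rw [integral_exp_mul_sq_gaussianReal hs]; exact hs.ne')

/-- Upper tail of the squared Euclidean norm of an i.i.d. Bernoulli–Gaussian vector. -/
lemma pi_bernoulliGaussian_real_sum_sq_ge_le_exp {p : ℝ} (hp0 : 0 ≤ p) (hp1 : p ≤ 1)
    {ι : Type*} [Fintype ι] {ε : ℝ} (hε : 0 ≤ ε) :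
    (Measure.pi fun _ : ι => bernoulliGaussian p).real
        {x | Fintype.card ι * p * (1 + ε) ^ 2 ≤ ∑ i, x i ^ 2}
      ≤ Real.exp (-(Fintype.card ι * p * ε ^ 2 / 2)) := by
  have := isProbabilityMeasure_bernoulliGaussian hp0 hp1
  have hs : 0 < 1 + ε := by linarith
  set t : ℝ := (1 - ((1 + ε) ^ 2)⁻¹) / 2 with ht
  have ht0 : 0 ≤ t := by
    have : ((1 + ε) ^ 2)⁻¹ ≤ 1 := inv_le_one_of_one_le₀ (by nlinarith)
    linarith
  have hint : Integrable (fun x => Real.exp (t * x ^ 2)) (bernoulliGaussian p) :=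
    integrable_bernoulliGaussian p (integrable_exp_mul_sq_gaussianReal hs)
  have hmgf : mgf (fun x => x ^ 2) (bernoulliGaussian p) t ≤ Real.exp (p * ε) := by
    rw [mgf, integral_bernoulliGaussian hp0 hp1 (f := fun x => Real.exp (t * x ^ 2))
      (integrable_exp_mul_sq_gaussianReal hs), integral_exp_mul_sq_gaussianReal hs]
    refine le_trans (le_of_eq ?_) (Real.add_one_le_exp _)
    simp
    ring
  have hind : iIndepFun (fun (i : ι) (x : ι → ℝ) => x i ^ 2)
      (Measure.pi fun _ => bernoulliGaussian p) :=
    iIndepFun_pi (X := fun _ y => y ^ 2) fun _ => by fun_prop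
  have hmeas (i : ι) : Measurable fun x : ι → ℝ => x i ^ 2 := by fun_prop
  have h := measure_ge_le_exp_mul_mgf (μ := Measure.pi fun _ : ι => bernoulliGaussian p)
    (X := ∑ i, fun x : ι → ℝ => x i ^ 2) (t := t) (Fintype.card ι * p * (1 + ε) ^ 2) ht0
    (hind.integrable_exp_mul_sum hmeas fun i _ =>
      integrable_comp_eval (μ := fun _ : ι => bernoulliGaussian p)
        (f := fun y => Real.exp (t * y ^ 2)) hint)
  rw [hind.mgf_sum hmeas] at h
  have hm (i : ι) : mgf (fun x : ι → ℝ => x i ^ 2) (Measure.pi fun _ => bernoulliGaussian p) t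
      = mgf (fun x => x ^ 2) (bernoulliGaussian p) t :=
    integral_comp_eval (μ := fun _ : ι => bernoulliGaussian p)
      (f := fun y => Real.exp (t * y ^ 2)) hint.aestronglyMeasurable
  simp only [hm, Finset.prod_const, Finset.card_univ, Finset.sum_apply] at h
  refine h.trans ((mul_le_mul_of_nonneg_left (pow_le_pow_left₀ mgf_nonneg hmgf _)
    (Real.exp_nonneg _)).trans_eq ?_)
  rw [← Real.exp_nat_mul, ← Real.exp_add, ht]
  congr 1
  field_simp
  ring

lemma measurePreserving_swap_uncurry_pi {ι κ X : Type*} [Fintype ι] [Fintype κ]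
    [MeasurableSpace X] (ν : Measure X) [SigmaFinite ν] :
    MeasurePreserving (fun (x : κ → ι → X) (q : ι × κ) => x q.2 q.1)
      (Measure.pi fun _ => Measure.pi fun _ => ν) (Measure.pi fun _ => ν) := by
  have hmeas : Measurable fun (x : κ → ι → X) (q : ι × κ) => x q.2 q.1 := by fun_prop
  refine ⟨hmeas, (Measure.pi_eq fun s hs => ?_).symm⟩
  rw [Measure.map_apply hmeas (MeasurableSet.univ_pi hs)]
  have : (fun (x : κ → ι → X) (q : ι × κ) => x q.2 q.1) ⁻¹' Set.univ.pi s
      = Set.univ.pi fun i => Set.univ.pi fun l => s (l, i) := by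
    ext x
    simp only [Set.mem_preimage, Set.mem_univ_pi, Prod.forall]
    exact forall_comm
  rw [this, Measure.pi_pi]
  simp_rw [Measure.pi_pi]
  rw [Fintype.prod_prod_type, Finset.prod_comm]

/-- Lower tail of `‖Aᵀz‖₁` for a fixed unit vector `z`. -/
lemma pi_bernoulliGaussian_real_sum_abs_le_le_exp {p : ℝ} (hp0 : 0 ≤ p) (hp1 : p ≤ 1)
    {ι κ : Type*} [Fintype ι] [Fintype κ] {z : ι → ℝ} (hz : ∑ l, z l ^ 2 = 1)
    {ε : ℝ} (hε : 0 ≤ ε) :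
    (Measure.pi fun _ : ι × κ => bernoulliGaussian p).real
        {ω | ∑ i, |∑ l, ω (l, i) * z l|
          ≤ Fintype.card κ * (p * Real.sqrt (2 / Real.pi) - p * ε)}
      ≤ Real.exp (-(Fintype.card κ * p * ε ^ 2 / 2)) := by
  have := isProbabilityMeasure_bernoulliGaussian hp0 hp1
  have hmp := measurePreserving_swap_uncurry_pi (ι := ι) (κ := κ) (bernoulliGaussian p)
  have hset : MeasurableSet {ω : ι × κ → ℝ | ∑ i, |∑ l, ω (l, i) * z l|
      ≤ Fintype.card κ * (p * Real.sqrt (2 / Real.pi) - p * ε)} :=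
    measurableSet_le (by fun_prop) (by fun_prop)
  rw [← hmp.measureReal_preimage hset.nullMeasurableSet]
  refine pi_real_sum_le_le_exp (Q := Measure.pi fun _ : ι => bernoulliGaussian p)
    (f := fun x => |∑ l, x l * z l|) (by fun_prop) (fun x => abs_nonneg _)
    (memLp_linear_pi_bernoulliGaussian hp0 hp1 z).abs
    (le_integral_abs_linear_pi_bernoulliGaussian hp0 hp1 hz) ?_ hε
  simp_rw [sq_abs]
  rw [integral_linear_sq_pi_bernoulliGaussian hp0 hp1, hz, mul_one]

lemma sq_sum_abs_sum_mul_le {ι κ : Type*} [Fintype ι] [Fintype κ] (ω : ι × κ → ℝ) (w : ι → ℝ) :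
    (∑ i, |∑ l, ω (l, i) * w l|) ^ 2
      ≤ Fintype.card κ * ((∑ q, ω q ^ 2) * ∑ l, w l ^ 2) := by
  have h := sq_sum_le_card_mul_sum_sq (s := Finset.univ) (f := fun i => |∑ l, ω (l, i) * w l|)
  refine h.trans ?_
  rw [Finset.card_univ, Fintype.sum_prod_type, Finset.sum_comm, Finset.sum_mul]
  gcongr with i
  rw [sq_abs]
  exact Finset.sum_mul_sq_le_sq_mul_sq _ _ _

/-- **Corollary (inscribed ball radius of a random polytope).** If `A` is a random
`L×M` matrix with i.i.d. Bernoulli–Gaussian entries of parameter `p`, and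
`R₂(A) = inf_{z≠0} ‖Aᵀz‖₁/‖z‖₂`, then for `ε ∈ (0,1)`,
`ℙ(R₂(A) < Mp(√(2/π)−2ε−ε²)) ≤ 2·[(3/ε·√(L/p))^L + 1]·exp(−Mpε²/(2+√2·ε))`. -/
theorem stmt17 (p : ℝ) (hp0 : 0 < p) (hp1 : p < 1) (L M : ℕ) (hL : 0 < L) (hM : 0 < M)
    (ε : ℝ) (hε0 : 0 < ε) (hε1 : ε < 1) :
    Measure.pi (fun _ : Fin L × Fin M => bernoulliGaussian p)
      {ω | ∃ z : Fin L → ℝ, z ≠ 0 ∧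
        (∑ i, |∑ l, ω (l, i) * z l|) / Real.sqrt (∑ l, z l ^ 2)
          < M * p * (Real.sqrt (2 / Real.pi) - 2 * ε - ε ^ 2)}
      ≤ ENNReal.ofReal (2 * ((3 / ε * Real.sqrt (L / p)) ^ L + 1)
          * Real.exp (-(M * p * ε ^ 2) / (2 + Real.sqrt 2 * ε))) := by
  have := isProbabilityMeasure_bernoulliGaussian hp0.le hp1.le
  set P := Measure.pi fun _ : Fin L × Fin M => bernoulliGaussian p with hP
  have hL1 : (1 : ℝ) ≤ L := by exact_mod_cast hL
  have hM1 : (1 : ℝ) ≤ M := by exact_mod_cast hM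
  set δ := ε * Real.sqrt (p / L) with hδ
  have hδ0 : 0 < δ := by positivity
  have hδ1 : δ ≤ 1 := by
    have : Real.sqrt (p / L) ≤ 1 :=
      Real.sqrt_le_one.2 ((div_le_one (by positivity)).2 (by linarith))
    nlinarith [Real.sqrt_nonneg (p / L)]
  have hδsq : δ ^ 2 = ε ^ 2 * (p / L) := by
    rw [hδ, mul_pow, Real.sq_sqrt (by positivity)]
  obtain ⟨s, hs1, hscard, hsnet⟩ :=
    exists_finset_net_sphere (E := EuclideanSpace ℝ (Fin L)) hδ0 hδ1
  have hdiv : 3 / δ = 3 / ε * Real.sqrt (L / p) := by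
    rw [hδ, ← inv_div (p : ℝ) L, Real.sqrt_inv]
    field_simp
  rw [finrank_euclideanSpace_fin, hdiv] at hscard
  set e := Real.exp (-(M * p * ε ^ 2 / 2)) with he
  let B₀ : Set (Fin L × Fin M → ℝ) := {ω | (L * M : ℕ) * p * (1 + ε) ^ 2 ≤ ∑ q, ω q ^ 2}
  let B : EuclideanSpace ℝ (Fin L) → Set (Fin L × Fin M → ℝ) := fun c =>
    {ω | ∑ i, |∑ l, ω (l, i) * c l| ≤ M * (p * Real.sqrt (2 / Real.pi) - p * ε)}
  have hB₀ : P.real B₀ ≤ e := by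
    have h := pi_bernoulliGaussian_real_sum_sq_ge_le_exp (ι := Fin L × Fin M) hp0.le hp1.le hε0.le
    rw [Fintype.card_prod, Fintype.card_fin, Fintype.card_fin] at h
    refine h.trans (Real.exp_le_exp.2 ?_)
    push_cast
    have : 0 ≤ M * p * ε ^ 2 := by positivity
    nlinarith
  have hB (c : EuclideanSpace ℝ (Fin L)) (hc : c ∈ s) : P.real (B c) ≤ e := by
    have hc1 : ∑ l, c l ^ 2 = 1 := by
      rw [← EuclideanSpace.real_norm_sq_eq, hs1 c hc, one_pow]
    have h := pi_bernoulliGaussian_real_sum_abs_le_le_exp (κ := Fin M) hp0.le hp1.le hc1 hε0.le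
    rwa [Fintype.card_fin] at h
  have hsub : {ω : Fin L × Fin M → ℝ | ∃ z : Fin L → ℝ, z ≠ 0 ∧
        (∑ i, |∑ l, ω (l, i) * z l|) / Real.sqrt (∑ l, z l ^ 2)
          < M * p * (Real.sqrt (2 / Real.pi) - 2 * ε - ε ^ 2)} ⊆ B₀ ∪ ⋃ c ∈ s, B c := by
    rintro ω ⟨z, hz0, hz⟩
    by_contra hω
    simp only [Set.mem_union, Set.mem_iUnion, not_or, not_exists] at hω
    obtain ⟨hω₀, hω⟩ := hω
    have hω₀' : ∑ q, ω q ^ 2 ≤ (L * M : ℕ) * p * (1 + ε) ^ 2 := (not_le.1 hω₀).le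
    set r := Real.sqrt (∑ l, z l ^ 2) with hr
    have hrn : r = ‖(WithLp.toLp 2 z : EuclideanSpace ℝ (Fin L))‖ := by
      rw [EuclideanSpace.norm_eq]
      simp [hr]
    have hr0 : 0 < r := by
      rw [hrn, norm_pos_iff]
      simpa using hz0
    let u : EuclideanSpace ℝ (Fin L) := r⁻¹ • WithLp.toLp 2 z
    have hu : ‖u‖ = 1 := by
      rw [norm_smul, ← hrn, Real.norm_of_nonneg (by positivity), inv_mul_cancel₀ hr0.ne']
    obtain ⟨c, hc, huc⟩ := hsnet u hu
    have hsum_u : ∑ i, |∑ l, ω (l, i) * u l| = (∑ i, |∑ l, ω (l, i) * z l|) / r := by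
      rw [div_eq_inv_mul, Finset.mul_sum]
      refine Finset.sum_congr rfl fun i _ => ?_
      rw [← abs_of_pos (inv_pos.2 hr0), ← abs_mul, Finset.mul_sum]
      congr 1
      refine Finset.sum_congr rfl fun l _ => ?_
      simp only [u, PiLp.smul_apply, smul_eq_mul]
      ring
    have htri : ∑ i, |∑ l, ω (l, i) * c l|
        ≤ ∑ i, |∑ l, ω (l, i) * u l| + ∑ i, |∑ l, ω (l, i) * (u - c) l| := by
      rw [← Finset.sum_add_distrib]
      refine Finset.sum_le_sum fun i _ => ?_
      have : ∑ l, ω (l, i) * c l = ∑ l, ω (l, i) * u l - ∑ l, ω (l, i) * (u - c) l := by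
        rw [← Finset.sum_sub_distrib]
        refine Finset.sum_congr rfl fun l _ => ?_
        rw [PiLp.sub_apply]
        ring
      rw [this]
      exact abs_sub _ _
    have hdiff : ∑ i, |∑ l, ω (l, i) * (u - c) l| ≤ M * p * (ε * (1 + ε)) := by
      refine le_of_sq_le_sq ?_ (by positivity)
      refine (sq_sum_abs_sum_mul_le ω _).trans ?_
      have hw : ∑ l, (u - c) l ^ 2 ≤ ε ^ 2 * (p / L) := by
        rw [← EuclideanSpace.real_norm_sq_eq, ← hδsq]
        gcongr
      rw [Fintype.card_fin]
      calc (M : ℝ) * ((∑ q, ω q ^ 2) * ∑ l, (u - c) l ^ 2)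
          ≤ M * (((L * M : ℕ) * p * (1 + ε) ^ 2) * (ε ^ 2 * (p / L))) := by gcongr
        _ = (M * p * (ε * (1 + ε))) ^ 2 := by
          push_cast
          field_simp
    have hcB : M * (p * Real.sqrt (2 / Real.pi) - p * ε) < ∑ i, |∑ l, ω (l, i) * c l| :=
      not_le.1 (hω c hc)
    rw [← hsum_u] at hz
    nlinarith
  have hexp : e ≤ Real.exp (-(M * p * ε ^ 2) / (2 + Real.sqrt 2 * ε)) := by
    rw [he, neg_div]
    gcongr
    have : 0 ≤ Real.sqrt 2 * ε := by positivity
    linarith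
  have hmeas : P.real (B₀ ∪ ⋃ c ∈ s, B c) ≤ (s.card + 1) * e := by
    refine (measureReal_union_le _ _).trans ?_
    have h := (measureReal_biUnion_finset_le s B (μ := P)).trans (Finset.sum_le_sum hB)
    rw [Finset.sum_const, nsmul_eq_mul] at h
    linarith
  refine (measure_mono hsub).trans ?_
  rw [← ofReal_measureReal]
  refine ENNReal.ofReal_le_ofReal (hmeas.trans ?_)
  gcongr
  have : (0 : ℝ) ≤ s.card := by positivity
  linarith
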